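/- Let I be a finite nonempty monotonic set of intervals with pairwise distinct finishing times, let m be the ≼-least interval of I, and let J be the greedy optimal set of I. Then every interval of J lies on the ancestor chain of m in the linearised tree L(I); that is, J is contained in the set consisting of m and all iterated parents of m in L(I). -/

import Mathlib

/-- Two intervals (given as pairs (start, finish)) are compatible if one
finishes strictly before the other starts. -/
def Compatible (i j : ℝ × ℝ) : Prop := i.2 < j.1 ∨ j.2 < i.1

/-- `j` is the right compatible interval of `i` in `I`: the ≼-least element of
`I` compatible with `i` and strictly after `i` in the ordering by finishing time. -/
def IsRC (I : Finset (ℝ × ℝ)) (i j : ℝ × ℝ) : Prop :=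
  j ∈ I ∧ i.2 < j.2 ∧ Compatible i j ∧
    ∀ k ∈ I, i.2 < k.2 → Compatible i k → j.2 ≤ k.2

/-- A set of intervals is monotonic if no interval properly contains another. -/
def Monotonic (I : Finset (ℝ × ℝ)) : Prop :=
  ∀ i ∈ I, ∀ j ∈ I, i ≠ j → ¬(i.1 ≤ j.1 ∧ j.2 ≤ i.2)

/-- Equivalence edge of the linearised tree: `i ∼ j` (same right compatible
interval) and `i` is the ≼-predecessor of `j` in `I`. -/
def ESim (I : Finset (ℝ × ℝ)) (i j : ℝ × ℝ) : Prop :=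
  i ∈ I ∧ j ∈ I ∧ (∃ r, IsRC I i r ∧ IsRC I j r) ∧
    i.2 < j.2 ∧ ∀ k ∈ I, i.2 < k.2 → j.2 ≤ k.2

/-- Compatibility edge of the linearised tree: `rc(i)` exists, `i` is the
≼-greatest element of its equivalence class `[i]`, and `j = rc(i)`. -/
def EC (I : Finset (ℝ × ℝ)) (i j : ℝ × ℝ) : Prop :=
  i ∈ I ∧ IsRC I i j ∧ ∀ k ∈ I, IsRC I k j → k.2 ≤ i.2

/-- An edge of the linearised tree `L(I)` (union of the two edge sets). -/
def LTEdge (I : Finset (ℝ × ℝ)) (i j : ℝ × ℝ) : Prop :=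
  ESim I i j ∨ EC I i j

/-- `m` is the ≼-least interval of `I` (ordering by finishing time). -/
def IsLeastInterval (I : Finset (ℝ × ℝ)) (m : ℝ × ℝ) : Prop :=
  m ∈ I ∧ ∀ j ∈ I, m.2 ≤ j.2

/-- Membership in the greedy optimal set of `I`. -/
inductive InGreedy (I : Finset (ℝ × ℝ)) : ℝ × ℝ → Prop
  | base (m : ℝ × ℝ) : IsLeastInterval I m → InGreedy I m
  | step (i j : ℝ × ℝ) : InGreedy I i → IsRC I i j → InGreedy I j

/-- `x` lies on the ancestor chain of `m` in the linearised tree `L(I)`: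
`x` is `m` or an iterated parent of `m`. -/
def OnAncestorChain (I : Finset (ℝ × ℝ)) (m x : ℝ × ℝ) : Prop :=
  Relation.ReflTransGen (LTEdge I) m x

theorem InGreedy.mem {I : Finset (ℝ × ℝ)} {x : ℝ × ℝ} (h : InGreedy I x) : x ∈ I := by
  cases h with
  | base _ h => exact h.1
  | step _ _ _ h => exact h.1

/-- An interval compatible with `i` that finishes after `i` also starts after `i` finishes. -/
theorem Compatible.finish_lt_start {i j : ℝ × ℝ} (h : Compatible i j) (hi : i.1 < i.2)
    (hij : i.2 < j.2) : i.2 < j.1 :=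
  h.resolve_right fun hji => by linarith

/-- The classes of intervals with the same right compatible interval are convex in the
ordering by finishing time. -/
theorem IsRC.of_between {I : Finset (ℝ × ℝ)} {i p k j : ℝ × ℝ} (hp : p.1 < p.2)
    (hk : k.1 < k.2) (hi : IsRC I i j) (hkj : IsRC I k j) (hip : i.2 ≤ p.2) (hpk : p.2 ≤ k.2) :
    IsRC I p j := by
  refine ⟨hi.1, hpk.trans_lt hkj.2.1,
    Or.inl (hpk.trans_lt (hkj.2.2.1.finish_lt_start hk hkj.2.1)), fun l hl hpl hc => ?_⟩
  exact hi.2.2.2 l hl (hip.trans_lt hpl)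
    (Or.inl (hip.trans_lt (hc.finish_lt_start hp hpl)))

/-- The right compatible interval of `i` is an iterated parent of `i` in the linearised tree. -/
theorem IsRC.onAncestorChain {I : Finset (ℝ × ℝ)} (hval : ∀ i ∈ I, i.1 < i.2)
    {i j : ℝ × ℝ} (hi : i ∈ I) (hij : IsRC I i j) : OnAncestorChain I i j := by
  induction hn : (I.filter fun k => i.2 < k.2).card using Nat.strong_induction_on
    generalizing i with
  | _ n ih =>
    by_cases hmax : ∀ k ∈ I, IsRC I k j → k.2 ≤ i.2
    · exact .single (Or.inr ⟨hi, hij, hmax⟩)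
    push Not at hmax
    obtain ⟨k, hk, hkj, hik⟩ := hmax
    obtain ⟨p, hp, hpmin⟩ := (I.filter fun k => i.2 < k.2).exists_min_image Prod.snd
      ⟨k, Finset.mem_filter.2 ⟨hk, hik⟩⟩
    obtain ⟨hpI, hip⟩ := Finset.mem_filter.1 hp
    have hsucc : ∀ l ∈ I, i.2 < l.2 → p.2 ≤ l.2 := fun l hl hil =>
      hpmin l (Finset.mem_filter.2 ⟨hl, hil⟩)
    have hpj : IsRC I p j :=
      hij.of_between (hval p hpI) (hval k hk) hkj hip.le (hsucc k hk hik)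
    refine .head (Or.inl ⟨hi, hpI, ⟨j, hij, hpj⟩, hip, hsucc⟩) (ih _ ?_ hpI hpj rfl)
    rw [← hn]
    refine Finset.card_lt_card (Finset.ssubset_iff_of_subset ?_ |>.2 ⟨p, hp, by simp⟩)
    exact Finset.monotone_filter_right I fun l _ hl => hip.trans hl

/-- For a nonempty monotonic set `I` with ≼-least interval `m`, every interval
of the greedy optimal set lies on the ancestor chain of `m` in the linearised
tree `L(I)`. -/
theorem greedy_subset_ancestor_chain (I : Finset (ℝ × ℝ)) (hne : I.Nonempty)
    (hval : ∀ i ∈ I, i.1 < i.2)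
    (hdist : ∀ i ∈ I, ∀ j ∈ I, i.2 = j.2 → i = j)
    (hmono : Monotonic I)
    (m : ℝ × ℝ) (hm : IsLeastInterval I m) :
    ∀ x : ℝ × ℝ, InGreedy I x → OnAncestorChain I m x := by
  intro x hx
  induction hx with
  | base x hx =>
    rw [hdist x hx.1 m hm.1 (le_antisymm (hx.2 m hm.1) (hm.2 x hx.1))]
    exact .refl
  | step i j hi hij ih => exact ih.trans (hij.onAncestorChain hval hi.mem)
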